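/- There is no set T of sign vectors on Fin 8 (maps Fin 8 → {−1,1}) such that: T is closed under negation; |T| = 58 (= 2·(C(7,0)+C(7,1)+C(7,2)), the tope count of a rank-3 uniform oriented matroid on 8 elements); S2(8) ⊆ T ⊆ S1(8); and T satisfies the VC condition for rank 3. (This is the combinatorial content of the paper's main theorem: there is no uniform rank-3 oriented matroid M′ with strong maps M1 → M′ → M2, where M1 is the rank-4 alternating oriented matroid on 8 elements, so the strong map f : M1 → M2 is not factorizable into extensions and contractions.) -/

import Mathlib

/-- A sign vector on `Fin n`: every entry is `1` or `-1`. -/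
def IsSignVec {n : ℕ} (v : Fin n → ℤ) : Prop := ∀ i, v i = 1 ∨ v i = -1

/-- The number of sign changes of `v`. -/
def signChanges {n : ℕ} (v : Fin n → ℤ) : ℕ :=
  (Finset.univ.filter
    (fun i : Fin (n - 1) =>
      v ⟨i.val, by omega⟩ ≠ v ⟨i.val + 1, by omega⟩)).card

/-- The permutation σ of `{1,…,n}` (on values) swapping `2j-1` and `2j`. -/
def pairSwap (m : ℕ) : ℕ := if m % 2 = 1 then m + 1 else m - 1

/-- The tope `v_k` of the rank-2 oriented matroid `M₂`. -/
def vk (n k : ℕ) : Fin n → ℤ := fun i => if k < pairSwap (i.val + 1) then 1 else -1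

/-- Topes of the rank-2 oriented matroid `M₂` on `n` elements. -/
def S2 (n : ℕ) : Set (Fin n → ℤ) := {v | ∃ k ≤ n, v = vk n k ∨ v = -vk n k}

/-- The VC condition for rank 3. -/
def VCCondition {n : ℕ} (T : Finset (Fin n → ℤ)) : Prop :=
  ∀ Q : Finset (Fin n), Q.card = 4 →
    ∃ c : Fin n → ℤ,
      (∀ i, c i = 1 ∨ c i = 0 ∨ c i = -1) ∧
      (∀ i, c i ≠ 0 ↔ i ∈ Q) ∧
      (∀ t ∈ T, ¬ ∀ i ∈ Q, t i = c i) ∧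
      (∀ t ∈ T, ¬ ∀ i ∈ Q, t i = -c i)

open Finset

/-! ### Families closed under complement that shatter no large set -/

section Families

variable {α : Type*} [DecidableEq α]

/-- A family of subsets of `W` that is closed under complementation in `W`. -/
def IsComplClosedOn (W : Finset α) (𝒜 : Finset (Finset α)) : Prop :=
  ∀ A ∈ 𝒜, A ⊆ W ∧ W \ A ∈ 𝒜

theorem Finset.Shatters.subset_of_forall_subset {W Q : Finset α} {𝒜 : Finset (Finset α)}
    (h𝒜 : ∀ A ∈ 𝒜, A ⊆ W) (hQ : 𝒜.Shatters Q) : Q ⊆ W := by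
  obtain ⟨u, hu, huQ⟩ := hQ (Finset.Subset.refl Q)
  exact (Finset.inter_eq_left.1 huQ).trans (h𝒜 u hu)

/-- If the members of `𝒜` avoiding `a` shatter `R`, then `𝒜` shatters `insert a R`. -/
theorem IsComplClosedOn.shatters_insert {W R : Finset α} {𝒜 : Finset (Finset α)}
    (h𝒜 : IsComplClosedOn W 𝒜) {a : α} (ha : a ∈ W)
    (hR : (𝒜.filter (a ∉ ·)).Shatters R) : 𝒜.Shatters (insert a R) := by
  have hRW : R ⊆ W :=
    hR.subset_of_forall_subset fun A hA => (h𝒜 A (mem_filter.1 hA).1).1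
  intro t ht
  by_cases hat : a ∈ t
  · obtain ⟨u, hu, hut⟩ := hR (t := R \ t) sdiff_subset
    rw [mem_filter] at hu
    refine ⟨W \ u, (h𝒜 u hu.1).2, ?_⟩
    ext x
    have h1 := Finset.ext_iff.1 hut x
    have h2 := @ht x
    have h3 := @hRW x
    simp only [mem_inter, mem_sdiff, mem_insert] at *
    grind
  · obtain ⟨u, hu, hut⟩ := hR (t := t) fun x hx => by
      have := ht hx
      grind
    rw [mem_filter] at hu
    refine ⟨u, hu.1, ?_⟩
    rw [insert_inter_of_notMem hu.2, hut]

theorem IsComplClosedOn.card_le_two_mul_card {W : Finset α} {𝒜 : Finset (Finset α)}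
    (h𝒜 : IsComplClosedOn W 𝒜) (hW : W.Nonempty) (hvc : ∀ Q, #Q = 3 → ¬ 𝒜.Shatters Q) :
    #𝒜 ≤ 2 * #W := by
  obtain ⟨a, ha⟩ := hW
  have hle : #(𝒜.filter (a ∈ ·)) ≤ #(𝒜.filter (a ∉ ·)) := by
    refine card_le_card_of_injOn (W \ ·) (fun A hA => ?_) fun A hA B hB hAB => ?_
    · simp only [coe_filter, Set.mem_ofPred_eq, mem_sdiff] at hA ⊢
      exact ⟨(h𝒜 A hA.1).2, fun h => h.2 hA.2⟩
    · simp only [coe_filter, Set.mem_ofPred_eq] at hA hB hAB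
      rw [← Finset.sdiff_sdiff_eq_self (h𝒜 A hA.1).1, hAB,
        Finset.sdiff_sdiff_eq_self (h𝒜 B hB.1).1]
  have hsub : (𝒜.filter (a ∉ ·)).shatterer ⊆ insert ∅ ((W.erase a).image singleton) := by
    intro s hs
    rw [mem_shatterer] at hs
    have hsW : s ⊆ W.erase a := hs.subset_of_forall_subset fun A hA => by
      rw [mem_filter] at hA
      exact subset_erase.2 ⟨(h𝒜 A hA.1).1, hA.2⟩
    have hs1 : #s ≤ 1 := by
      by_contra! h
      obtain ⟨R, hRs, hR⟩ := exists_subset_card_eq (show 2 ≤ #s from h)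
      refine hvc (insert a R) ?_ (h𝒜.shatters_insert ha (hs.mono_right hRs))
      rw [card_insert_of_notMem fun h => notMem_erase a W (hsW (hRs h)), hR]
    rcases Nat.le_one_iff_eq_zero_or_eq_one.1 hs1 with h | h
    · exact mem_insert.2 (Or.inl (card_eq_zero.1 h))
    · obtain ⟨x, rfl⟩ := card_eq_one.1 h
      exact mem_insert_of_mem (mem_image_of_mem _ (hsW (mem_singleton_self x)))
  have hbound : #(𝒜.filter (a ∉ ·)) ≤ #W := by
    refine (card_le_card_shatterer _).trans ((card_le_card hsub).trans ?_)
    refine (card_insert_le _ _).trans ?_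
    have h1 : #((W.erase a).image (singleton : α → Finset α)) ≤ _ := card_image_le
    have h2 := card_erase_add_one ha
    omega
  have := card_filter_add_card_filter_not (s := 𝒜) (a ∈ ·)
  omega

theorem IsComplClosedOn.card_le_card_image_erase {W : Finset α} {𝒜 : Finset (Finset α)}
    (h𝒜 : IsComplClosedOn W 𝒜) {e : α} (he : e ∈ W) (hW : (W.erase e).Nonempty)
    (hvc : ∀ Q, #Q = 4 → ¬ 𝒜.Shatters Q) :
    #𝒜 ≤ #(𝒜.image (·.erase e)) + 2 * #(W.erase e) := by
  set ℬ := 𝒜.memberSubfamily e ∩ 𝒜.nonMemberSubfamily e with hℬ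
  have hmem : ∀ A, A ∈ ℬ ↔ insert e A ∈ 𝒜 ∧ A ∈ 𝒜 ∧ e ∉ A := by
    intro A
    simp only [hℬ, mem_inter, mem_memberSubfamily, mem_nonMemberSubfamily]
    tauto
  have hclosed : IsComplClosedOn (W.erase e) ℬ := by
    intro A hA
    rw [hmem] at hA
    refine ⟨subset_erase.2 ⟨(h𝒜 A hA.2.1).1, hA.2.2⟩, (hmem _).2 ⟨?_, ?_, by simp⟩⟩
    · convert (h𝒜 A hA.2.1).2 using 1
      ext x
      simp only [mem_insert, mem_sdiff, mem_erase]
      grind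
    · convert (h𝒜 _ hA.1).2 using 1
      ext x
      simp only [mem_insert, mem_sdiff, mem_erase]
      grind
  have hle : #ℬ ≤ 2 * #(W.erase e) := by
    refine hclosed.card_le_two_mul_card hW fun Q hQ hsh => ?_
    have heQ : e ∉ Q := fun h =>
      notMem_erase e W (hsh.subset_of_forall_subset (fun A hA => (hclosed A hA).1) h)
    refine hvc (insert e Q) (by rw [card_insert_of_notMem heQ, hQ])
      (h𝒜.shatters_insert he (hsh.mono_left fun A hA => ?_))
    rw [hmem] at hA
    exact mem_filter.2 hA.2
  have h1 := card_memberSubfamily_add_card_nonMemberSubfamily e 𝒜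
  have h2 := card_union_add_card_inter (𝒜.memberSubfamily e) (𝒜.nonMemberSubfamily e)
  rw [memberSubfamily_union_nonMemberSubfamily, ← hℬ] at h2
  omega

/-- Deleting ground set elements from a complement-closed family without shattered 4-sets
loses at most as many members as in the case of a maximum family. -/
theorem card_add_le_card_image_inter_add [Fintype α] {𝒜 : Finset (Finset α)}
    (h𝒜 : ∀ A ∈ 𝒜, Aᶜ ∈ 𝒜) (hvc : ∀ Q, #Q = 4 → ¬ 𝒜.Shatters Q) {P : Finset α}
    (hP : P.Nonempty) :
    #𝒜 + #P * (#P - 1) ≤ #(𝒜.image (P ∩ ·)) + Fintype.card α * (Fintype.card α - 1) := by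
  suffices h : ∀ S : Finset α, #(𝒜.image ((S ∪ P) ∩ ·)) + #P * (#P - 1) ≤
      #(𝒜.image (P ∩ ·)) + #(S ∪ P) * (#(S ∪ P) - 1) by
    simpa [union_eq_left.2 (subset_univ P)] using h univ
  intro S
  induction S using Finset.induction_on with
  | empty => simp
  | insert e S _ ih =>
    by_cases heS : e ∈ S ∪ P
    · rwa [insert_union, insert_eq_of_mem heS]
    rw [insert_union]
    set W := S ∪ P
    have hclosed : IsComplClosedOn (insert e W) (𝒜.image (insert e W ∩ ·)) := by
      intro B hB
      obtain ⟨A, hA, rfl⟩ := mem_image.1 hB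
      refine ⟨inter_subset_left, mem_image.2 ⟨Aᶜ, h𝒜 A hA, ?_⟩⟩
      ext x
      simp only [mem_inter, mem_compl, mem_sdiff]
      tauto
    have hW : W.Nonempty := hP.mono subset_union_right
    have key := hclosed.card_le_card_image_erase (mem_insert_self e W)
      (by rwa [erase_insert heS]) fun Q hQ hsh => hvc Q hQ fun t ht => by
        have hQW : Q ⊆ insert e W :=
          hsh.subset_of_forall_subset fun A hA => (hclosed A hA).1
        obtain ⟨u, hu, hut⟩ := hsh ht
        obtain ⟨A, hA, rfl⟩ := mem_image.1 hu
        exact ⟨A, hA, by rw [← hut, ← inter_assoc, inter_eq_left.2 hQW]⟩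
    rw [erase_insert heS, image_image] at key
    have himg : 𝒜.image ((·.erase e) ∘ (insert e W ∩ ·)) = 𝒜.image (W ∩ ·) := by
      refine image_congr fun A _ => ?_
      ext x
      simp only [Function.comp, mem_erase, mem_inter, mem_insert]
      grind
    rw [himg] at key
    rw [card_insert_of_notMem heS]
    obtain ⟨w, hw⟩ : ∃ w, #W = w + 1 := ⟨#W - 1, by have := hW.card_pos; omega⟩
    rw [hw] at key ih ⊢
    simp only [Nat.add_sub_cancel] at ih ⊢
    nlinarith

end Families

/-! ### Bit masks and the search -/

/-- The bit mask of a subset of `Fin 8`. -/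
def bitMask (A : Finset (Fin 8)) : ℕ := Nat.ofBits fun i => decide (i ∈ A)

/-- The set of positions below 8 at which the bit mask `m` has a one. -/
def bitSet (m : ℕ) : Finset (Fin 8) := univ.filter fun i => m.testBit i

/-- The bit masks below 256 that are contained in `p`. -/
def subMasks (p : ℕ) : List ℕ := (List.range 256).filter fun x => x &&& p == x

/-- Whether `x` restricts to `f.2` or to its complement on `f.1`. -/
def hits (x : ℕ) (f : ℕ × ℕ) : Bool := x &&& f.1 == f.2 || x &&& f.1 == f.1 ^^^ f.2

/-- The number of bit masks contained in `p` that hit none of the pairs of `F` living on `p`. -/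
def avoidCount (F : List (ℕ × ℕ)) (p : ℕ) : ℕ :=
  ((subMasks p).filter fun x => F.all fun f => !(f.1 &&& p == f.1 && hits x f)).length

/-- The bit masks of the positive parts of the sign vectors `vk 8 k`. -/
def vkMasks : List ℕ := [255, 253, 252, 244, 240, 208, 192, 64, 0]

/-- The patterns on `q`, up to complement, that no `vk 8 k` restricts to. -/
def candidates (q : ℕ) : List ℕ :=
  (subMasks q).filter fun c => decide (c < q ^^^ c) && vkMasks.all fun m => !hits m (q, c)

/-- Exhaustive search for missing patterns on the quadruples in the list. The result `true` means
that every choice leaves too few patterns on some 5-set. -/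
def searchFails : List (ℕ × ℕ) → List (ℕ × ℕ) → Bool
  | [], _ => false
  | (q, p) :: rest, F => (candidates q).all fun c =>
      decide (avoidCount ((q, c) :: F) p < 22) || searchFails rest ((q, c) :: F)

/-- The 4-sets examined by the search, each paired with a 5-set containing it. -/
def searchSteps : List (ℕ × ℕ) :=
  [(15, 31), (23, 31), (27, 31), (29, 31), (30, 31), (43, 59), (51, 59), (57, 59), (58, 59),
   (46, 62), (54, 62), (60, 62), (83, 115), (99, 115), (113, 115), (114, 115), (147, 211),
   (195, 211), (209, 211), (210, 211), (177, 241), (225, 241), (240, 241)]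

/-- Six 5-sets with their alternating patterns. -/
def alternatingPairs : List (ℕ × ℕ) :=
  [(31, 21), (59, 41), (62, 42), (115, 81), (211, 145), (241, 161)]

theorem searchFails_searchSteps : searchFails searchSteps alternatingPairs = true := by
  decide +kernel

theorem testBit_bitMask (A : Finset (Fin 8)) (i : ℕ) :
    (bitMask A).testBit i = decide (∃ h : i < 8, (⟨i, h⟩ : Fin 8) ∈ A) := by
  by_cases h : i < 8
  · simp [bitMask, Nat.testBit_ofBits_lt _ _ h, h]
  · simp [bitMask, Nat.testBit_ofBits_ge _ _ (not_lt.1 h), h]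

theorem bitMask_lt (A : Finset (Fin 8)) : bitMask A < 256 := Nat.ofBits_lt_two_pow _

theorem bitMask_injective : Function.Injective bitMask := by
  intro A B h
  ext i
  have := congrArg (Nat.testBit · i) h
  simpa [testBit_bitMask] using this

theorem bitMask_inter (A B : Finset (Fin 8)) : bitMask (A ∩ B) = bitMask A &&& bitMask B := by
  refine Nat.eq_of_testBit_eq fun i => ?_
  by_cases h : i < 8 <;> simp [testBit_bitMask, h]

theorem bitMask_sdiff {A B : Finset (Fin 8)} (hBA : B ⊆ A) :
    bitMask (A \ B) = bitMask A ^^^ bitMask B := by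
  refine Nat.eq_of_testBit_eq fun i => ?_
  by_cases h : i < 8
  · have := @hBA ⟨i, h⟩
    by_cases hA : (⟨i, h⟩ : Fin 8) ∈ A <;> by_cases hB : (⟨i, h⟩ : Fin 8) ∈ B <;>
      simp_all [testBit_bitMask]
  · simp [testBit_bitMask, h]

theorem bitMask_bitSet {m : ℕ} (hm : m < 256) : bitMask (bitSet m) = m := by
  refine Nat.eq_of_testBit_eq fun i => ?_
  by_cases h : i < 8
  · simp [testBit_bitMask, bitSet, h]
  · have : m < 2 ^ i := hm.trans_le (Nat.pow_le_pow_right (n := 2) (by norm_num) (not_lt.1 h))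
    simp [testBit_bitMask, h, Nat.testBit_lt_two_pow this]

theorem bitSet_bitMask (A : Finset (Fin 8)) : bitSet (bitMask A) = A :=
  bitMask_injective (bitMask_bitSet (bitMask_lt A))

theorem mem_subMasks {x p : ℕ} : x ∈ subMasks p ↔ x < 256 ∧ x &&& p = x := by
  simp [subMasks]

/-- No member of `𝒜` hits the pair `f`. -/
def IsMissing (𝒜 : Finset (Finset (Fin 8))) (f : ℕ × ℕ) : Prop :=
  ∀ A ∈ 𝒜, hits (bitMask A) f = false

theorem card_image_inter_le_avoidCount {𝒜 : Finset (Finset (Fin 8))} {F : List (ℕ × ℕ)}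
    (hF : ∀ f ∈ F, IsMissing 𝒜 f) {p : ℕ} (hp : p < 256) :
    #(𝒜.image (bitSet p ∩ ·)) ≤ avoidCount F p := by
  refine le_trans ?_ (List.toFinset_card_le _)
  refine card_le_card_of_injOn bitMask (fun B hB => ?_) bitMask_injective.injOn
  obtain ⟨A, hA, rfl⟩ := mem_image.1 (mem_coe.1 hB)
  rw [mem_coe, List.mem_toFinset, List.mem_filter, mem_subMasks]
  refine ⟨⟨bitMask_lt _, ?_⟩, ?_⟩
  · rw [bitMask_inter, bitMask_bitSet hp, Nat.and_comm p, Nat.and_assoc, Nat.and_self]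
  · rw [List.all_eq_true]
    intro f hf
    have h := hF f hf A hA
    by_cases hfp : f.1 &&& p = f.1
    · have : bitMask (bitSet p ∩ A) &&& f.1 = bitMask A &&& f.1 := by
        rw [bitMask_inter, bitMask_bitSet hp, Nat.and_comm p, Nat.and_assoc, Nat.and_comm p, hfp]
      simpa [hits, this, hfp] using h
    · simp [hfp]

theorem hits_xor (x q c : ℕ) : hits x (q, q ^^^ c) = hits x (q, c) := by
  simp only [hits, ← Nat.xor_assoc, Nat.xor_self, Nat.zero_xor]
  exact Bool.or_comm _ _

theorem exists_isMissing_of_not_shatters {𝒜 : Finset (Finset (Fin 8))}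
    (h𝒜 : ∀ A ∈ 𝒜, Aᶜ ∈ 𝒜) {q : ℕ} (hq : q < 256) (hq0 : q ≠ 0)
    (hsh : ¬ 𝒜.Shatters (bitSet q)) :
    ∃ c ∈ subMasks q, c < q ^^^ c ∧ IsMissing 𝒜 (q, c) := by
  simp only [Finset.Shatters, not_forall, not_exists, not_and] at hsh
  obtain ⟨t, ht, hmiss⟩ := hsh
  have hsdiff : bitMask (bitSet q \ t) = q ^^^ bitMask t := by
    rw [bitMask_sdiff ht, bitMask_bitSet hq]
  have hsub : ∀ s ⊆ bitSet q, bitMask s ∈ subMasks q := fun s hs => by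
    refine mem_subMasks.2 ⟨bitMask_lt s, ?_⟩
    conv_lhs => rw [← bitMask_bitSet hq, ← bitMask_inter, inter_eq_left.2 hs]
  have hM : IsMissing 𝒜 (q, bitMask t) := by
    intro A hA
    have hAq : bitMask A &&& q = bitMask (bitSet q ∩ A) := by
      rw [bitMask_inter, bitMask_bitSet hq, Nat.and_comm]
    simp only [hits, Bool.or_eq_false_iff, beq_eq_false_iff_ne, hAq, ← hsdiff]
    refine ⟨fun h => hmiss A hA (bitMask_injective h), fun h => hmiss _ (h𝒜 A hA) ?_⟩
    rw [← sdiff_eq_inter_compl, ← sdiff_inter_self_left, bitMask_injective h,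
      Finset.sdiff_sdiff_eq_self ht]
  have hxor : q ^^^ (q ^^^ bitMask t) = bitMask t := by
    rw [← Nat.xor_assoc, Nat.xor_self, Nat.zero_xor]
  rcases lt_trichotomy (bitMask t) (q ^^^ bitMask t) with h | h | h
  · exact ⟨_, hsub t ht, h, hM⟩
  · rw [← h] at hxor
    exact absurd (Nat.xor_right_injective (x := bitMask t)
      (by simpa [Nat.xor_comm] using hxor)) hq0
  · refine ⟨_, hsdiff ▸ hsub _ sdiff_subset, by rwa [hxor], fun A hA => ?_⟩
    rw [hits_xor]
    exact hM A hA

theorem searchFails_eq_false {𝒜 : Finset (Finset (Fin 8))} :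
    ∀ {S F : List (ℕ × ℕ)},
      (∀ s ∈ S, ∃ c ∈ candidates s.1, IsMissing 𝒜 (s.1, c)) →
      (∀ s ∈ S, ∀ F, (∀ f ∈ F, IsMissing 𝒜 f) → 22 ≤ avoidCount F s.2) →
      (∀ f ∈ F, IsMissing 𝒜 f) → searchFails S F = false
  | [], _, _, _, _ => rfl
  | (q, p) :: S, F, hc, hcount, hF => by
    obtain ⟨c, hcq, hM⟩ := hc (q, p) List.mem_cons_self
    have hF' : ∀ f ∈ (q, c) :: F, IsMissing 𝒜 f := List.forall_mem_cons.2 ⟨hM, hF⟩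
    rw [searchFails, List.all_eq_false]
    refine ⟨c, hcq, ?_⟩
    have h22 := hcount (q, p) List.mem_cons_self _ hF'
    have hrec := searchFails_eq_false (fun s hs => hc s (List.mem_cons_of_mem _ hs))
      (fun s hs => hcount s (List.mem_cons_of_mem _ hs)) hF'
    simpa [hrec] using h22

theorem searchSteps_valid : ∀ s ∈ searchSteps,
    (s.1 < 256 ∧ s.1 ≠ 0 ∧ #(bitSet s.1) = 4) ∧ s.2 < 256 ∧ #(bitSet s.2) = 5 := by
  decide +kernel

/-- A complement-closed family on `Fin 8` that contains the positive parts of all `vk 8 k` and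
misses the alternating patterns on 5-sets shatters some 4-set or has fewer than 58 members. -/
theorem exists_shatters_of_le_card {𝒜 : Finset (Finset (Fin 8))}
    (h𝒜 : ∀ A ∈ 𝒜, Aᶜ ∈ 𝒜) (hcard : 58 ≤ #𝒜)
    (hvk : ∀ m ∈ vkMasks, ∃ A ∈ 𝒜, bitMask A = m)
    (halt : ∀ f ∈ alternatingPairs, IsMissing 𝒜 f) :
    ∃ Q, #Q = 4 ∧ 𝒜.Shatters Q := by
  by_contra! hvc
  refine Bool.false_ne_true ((searchFails_eq_false (𝒜 := 𝒜) (fun s hs => ?_)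
    (fun s hs F hF => ?_) halt).symm.trans searchFails_searchSteps)
  · obtain ⟨⟨hq, hq0, hq4⟩, -⟩ := searchSteps_valid s hs
    obtain ⟨c, hc, hlt, hM⟩ := exists_isMissing_of_not_shatters h𝒜 hq hq0 (hvc _ hq4)
    refine ⟨c, ?_, hM⟩
    simp only [candidates, List.mem_filter, Bool.and_eq_true, decide_eq_true_eq,
      List.all_eq_true]
    refine ⟨hc, hlt, fun m hm => ?_⟩
    obtain ⟨A, hA, rfl⟩ := hvk m hm
    rw [hM A hA, Bool.not_false]
  · obtain ⟨-, hp, hp5⟩ := searchSteps_valid s hs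
    have h1 := card_add_le_card_image_inter_add h𝒜 hvc (P := bitSet s.2)
      (card_pos.1 (by omega))
    have h2 := card_image_inter_le_avoidCount hF hp
    rw [hp5, Fintype.card_fin] at h1
    omega

/-! ### From sign vectors to sets -/

/-- The set of positions where `v` is `1`. -/
def positivePart {n : ℕ} (v : Fin n → ℤ) : Finset (Fin n) := univ.filter fun i => v i = 1

theorem IsSignVec.positivePart_neg {n : ℕ} {v : Fin n → ℤ} (hv : IsSignVec v) :
    positivePart (-v) = (positivePart v)ᶜ := by
  ext i
  rcases hv i with h | h <;> simp [positivePart, h]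

theorem IsSignVec.eq_ite {n : ℕ} {v : Fin n → ℤ} (hv : IsSignVec v) :
    v = fun i => if i ∈ positivePart v then 1 else -1 := by
  funext i
  rcases hv i with h | h <;> simp [positivePart, h]

theorem vkMasks_spec : ∀ m ∈ vkMasks, ∃ k ≤ 8, bitMask (positivePart (vk 8 k)) = m := by
  decide +kernel

theorem hits_alternatingPairs : ∀ m < 256,
    signChanges (fun i : Fin 8 => if i ∈ bitSet m then 1 else -1) ≤ 3 →
      ∀ f ∈ alternatingPairs, hits m f = false := by
  decide +kernel

/-- There is no uniform rank-3 oriented matroid `M'` with strong maps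
`M₁ → M' → M₂` on 8 elements: no negation-closed set of 58 sign vectors on
`Fin 8` sandwiched between the topes of `M₂` and the topes of the rank-4
alternating oriented matroid satisfies the VC condition for rank 3. -/
theorem no_factorization :
    ¬ ∃ T : Finset (Fin 8 → ℤ),
      (∀ v ∈ T, -v ∈ T) ∧
      T.card = 58 ∧
      (∀ v ∈ S2 8, v ∈ T) ∧
      (∀ v ∈ T, IsSignVec v ∧ signChanges v ≤ 3) ∧
      VCCondition T := by
  rintro ⟨T, hneg, hcard, hS2, hS1, hvc⟩
  have hshatters : ∃ Q, #Q = 4 ∧ (T.image positivePart).Shatters Q := by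
    refine exists_shatters_of_le_card ?_ ?_ ?_ ?_
    · intro A hA
      obtain ⟨t, ht, rfl⟩ := mem_image.1 hA
      exact mem_image.2 ⟨-t, hneg t ht, (hS1 t ht).1.positivePart_neg⟩
    · rw [card_image_of_injOn, hcard]
      intro s hs t ht hst
      rw [(hS1 s hs).1.eq_ite, (hS1 t ht).1.eq_ite, hst]
    · intro m hm
      obtain ⟨k, hk, rfl⟩ := vkMasks_spec m hm
      exact ⟨_, mem_image_of_mem _ (hS2 _ ⟨k, hk, Or.inl rfl⟩), rfl⟩
    · intro f hf A hA
      obtain ⟨t, ht, rfl⟩ := mem_image.1 hA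
      obtain ⟨hsign, hchanges⟩ := hS1 t ht
      refine hits_alternatingPairs _ (bitMask_lt _) ?_ f hf
      rwa [bitSet_bitMask, ← hsign.eq_ite]
  obtain ⟨Q, hQ, hsh⟩ := hshatters
  obtain ⟨c, hc, hc0, hpos, -⟩ := hvc Q hQ
  obtain ⟨u, hu, huQ⟩ := hsh (filter_subset (fun i => c i = 1) Q)
  obtain ⟨t, ht, rfl⟩ := mem_image.1 hu
  refine hpos t ht fun i hi => ?_
  have h1 := Finset.ext_iff.1 huQ i
  have h2 := (hc0 i).2 hi
  have h3 := (hS1 t ht).1 i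
  simp only [positivePart, mem_inter, mem_filter, mem_univ, true_and, hi] at h1
  have h4 := hc i
  omega
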